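/- Let a > 0, z > 0, and let F : [-1,1] → ℝ satisfy: F(1) = 1; -1 < F(t) < 1 for all t ∈ [-1,1); there is a constant F'(1) with 0 < F'(1) and constants C > 0, δ > 0 such that |F(t) - 1 + F'(1)·(1-t)| ≤ C·(1-t)^{3/2} for all t ∈ [1-δ, 1]. For n ≥ 2 set h_n = ⌊a·√(n/ln n)⌋ and P_n(a,z) = Φ( -F(1 - 2h_n/n)·z / √(1 - F(1 - 2h_n/n)²) ). Then there exist K > 0 and n₀ ∈ ℕ such that for all n ≥ n₀, | ln P_n(a,z) + z²·√(n·ln n)/(8·F'(1)·a) | ≤ K·(n·ln n)^{1/4}. -/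

import Mathlib

open Real MeasureTheory

/-- The standard normal cumulative distribution function. -/
noncomputable def Phi (t : ℝ) : ℝ := ∫ s in Set.Iic t, Real.exp (-s ^ 2 / 2) / Real.sqrt (2 * Real.pi)
lemma integrable_exp_neg_sq_div_two : Integrable fun s : ℝ => Real.exp (-s ^ 2 / 2) := by
  have h := integrable_exp_neg_mul_sq (b := 1 / 2) (by norm_num)
  refine h.congr (Filter.Eventually.of_forall fun s => ?_)
  ring_nf

lemma integral_exp_neg_sq_div_two :
    ∫ s : ℝ, Real.exp (-s ^ 2 / 2) = Real.sqrt (2 * Real.pi) := by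
  have h := integral_gaussian (1 / 2)
  rw [show π / (1 / 2) = 2 * π by ring] at h
  rw [← h]
  congr 1
  ext s
  ring_nf

lemma Phi_neg_le (x : ℝ) (hx : 0 ≤ x) : Phi (-x) ≤ Real.exp (-x ^ 2 / 2) := by
  have hc : 0 < Real.sqrt (2 * π) := by positivity
  have hi := integrable_exp_neg_sq_div_two
  have hi' := hi.comp_add_right x
  have hI : ∫ s : ℝ, Real.exp (-(s + x) ^ 2 / 2) = Real.sqrt (2 * π) := by
    rw [← integral_exp_neg_sq_div_two]
    exact integral_add_right_eq_self (fun s : ℝ => Real.exp (-s ^ 2 / 2)) x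
  unfold Phi
  rw [integral_div, div_le_iff₀ hc, ← hI, ← integral_const_mul]
  calc ∫ s in Set.Iic (-x), Real.exp (-s ^ 2 / 2)
      ≤ ∫ s in Set.Iic (-x), Real.exp (-x ^ 2 / 2) * Real.exp (-(s + x) ^ 2 / 2) := by
        refine setIntegral_mono_on hi.integrableOn (hi'.const_mul _).integrableOn
          measurableSet_Iic fun s hs => ?_
        rw [← Real.exp_add]
        have hs : s ≤ -x := hs
        apply Real.exp_le_exp.2
        nlinarith
    _ ≤ ∫ s, Real.exp (-x ^ 2 / 2) * Real.exp (-(s + x) ^ 2 / 2) :=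
        setIntegral_le_integral (hi'.const_mul _)
          (Filter.Eventually.of_forall fun s => by positivity)

lemma le_Phi_neg (x : ℝ) (hx : 0 ≤ x) :
    Real.exp (-(x + 1) ^ 2 / 2) / Real.sqrt (2 * π) ≤ Phi (-x) := by
  have hc : 0 < Real.sqrt (2 * π) := by positivity
  have hi := integrable_exp_neg_sq_div_two.div_const (Real.sqrt (2 * π))
  unfold Phi
  calc Real.exp (-(x + 1) ^ 2 / 2) / Real.sqrt (2 * π)
      = ∫ _s in Set.Icc (-x - 1) (-x), Real.exp (-(x + 1) ^ 2 / 2) / Real.sqrt (2 * π) := by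
        simp
    _ ≤ ∫ s in Set.Icc (-x - 1) (-x), Real.exp (-s ^ 2 / 2) / Real.sqrt (2 * π) := by
        refine setIntegral_mono_on (integrableOn_const (by simp)) hi.integrableOn
          measurableSet_Icc fun s hs => ?_
        gcongr ?_ / _
        apply Real.exp_le_exp.2
        nlinarith [hs.1, hs.2]
    _ ≤ ∫ s in Set.Iic (-x), Real.exp (-s ^ 2 / 2) / Real.sqrt (2 * π) :=
        setIntegral_mono_set hi.integrableOn
          (Filter.Eventually.of_forall fun s => by positivity)
          (Filter.Eventually.of_forall fun s hs => hs.2)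

lemma abs_log_Phi_neg_add_le (x : ℝ) (hx : 0 ≤ x) :
    |Real.log (Phi (-x)) + x ^ 2 / 2| ≤ x + 3 := by
  have hc : 0 < Real.sqrt (2 * π) := by positivity
  have hl : 0 < Real.exp (-(x + 1) ^ 2 / 2) / Real.sqrt (2 * π) := by positivity
  have h1 := Real.log_le_log hl (le_Phi_neg x hx)
  have h2 := Real.log_le_log (hl.trans_le (le_Phi_neg x hx)) (Phi_neg_le x hx)
  rw [Real.log_exp] at h2
  rw [Real.log_div (Real.exp_pos _).ne' hc.ne', Real.log_exp] at h1
  have h3 : Real.log (Real.sqrt (2 * π)) ≤ 2 := by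
    have h := Real.log_le_sub_one_of_pos hc
    have h' : Real.sqrt (2 * π) ≤ 3 := by
      rw [Real.sqrt_le_left (by norm_num)]
      linarith [Real.pi_lt_four]
    linarith
  rw [abs_le]
  constructor <;> nlinarith

lemma abs_odds_sub_le {D C v f : ℝ} (hD : 0 < D) (hC : 0 < C) (hv : 0 < v)
    (hCv : C * v ≤ D / 2) (hDv : 3 * D * v ^ 2 ≤ 1) (hf : |f - 1 + D * v ^ 2| ≤ C * v ^ 3) :
    1 / 2 ≤ f ∧ f < 1 ∧ f ^ 2 / (1 - f ^ 2) ≤ 1 / (D * v ^ 2) ∧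
      |f ^ 2 / (1 - f ^ 2) - 1 / (2 * D * v ^ 2)| ≤ 1 + C / (D ^ 2 * v) := by
  obtain ⟨w, rfl⟩ : ∃ w, f = 1 - w := ⟨1 - f, by ring⟩
  have hw : |D * v ^ 2 - w| ≤ C * v ^ 3 := by
    convert hf using 2
    ring
  have hCv3 : C * v ^ 3 ≤ D * v ^ 2 / 2 := by nlinarith [sq_nonneg v]
  have hDv0 : 0 < D * v ^ 2 := by positivity
  have hw1 : D * v ^ 2 / 2 ≤ w := by linarith [(abs_le.1 hw).2]
  have hw2 : w ≤ 1 / 2 := by linarith [(abs_le.1 hw).1]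
  have hw0 : 0 < w := by linarith
  have h2w : 0 < 2 - w := by linarith
  have hden : 1 - (1 - w) ^ 2 = w * (2 - w) := by ring
  have heq : (1 - w) ^ 2 / (1 - (1 - w) ^ 2) = 1 / (2 * w) + (1 / (2 * (2 - w)) - 1) := by
    rw [hden]
    field_simp
    ring
  have hb0 : 0 < 1 / (2 * (2 - w)) := by positivity
  have hb1 : 1 / (2 * (2 - w)) ≤ 1 := by
    rw [div_le_one (by positivity)]
    linarith
  refine ⟨by linarith, by linarith, ?_, ?_⟩
  · have : 1 / (2 * w) ≤ 1 / (D * v ^ 2) := one_div_le_one_div_of_le hDv0 (by linarith)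
    linarith
  · have hmain : |1 / (2 * w) - 1 / (2 * D * v ^ 2)| ≤ C / (D ^ 2 * v) := by
      have e : 1 / (2 * w) - 1 / (2 * D * v ^ 2) = (D * v ^ 2 - w) / (2 * w * (D * v ^ 2)) := by
        field_simp
      rw [e, abs_div, abs_of_pos (by positivity : 0 < 2 * w * (D * v ^ 2))]
      calc |D * v ^ 2 - w| / (2 * w * (D * v ^ 2))
          ≤ (C * v ^ 3) / (D * v ^ 2 * (D * v ^ 2)) :=
            div_le_div₀ (by positivity) hw (by positivity)
              (mul_le_mul_of_nonneg_right (by linarith) hDv0.le)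
        _ = C / (D ^ 2 * v) := by field_simp
    rw [heq]
    rw [abs_le] at hmain ⊢
    constructor <;> linarith [hmain.1, hmain.2]

lemma exists_abs_log_Phi_add_le (z : ℝ) (hz : 0 < z) (F : ℝ → ℝ) (D : ℝ) (hD : 0 < D)
    (C δ : ℝ) (hC : 0 < C) (hδ : 0 < δ)
    (hTaylor : ∀ t ∈ Set.Icc (1 - δ) 1,
      |F t - 1 + D * (1 - t)| ≤ C * (1 - t) ^ ((3 : ℝ) / 2)) :
    ∃ K > (0 : ℝ), ∃ u₀ > (0 : ℝ), ∀ u : ℝ, 0 < u → u ≤ u₀ →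
      |Real.log (Phi (-(F (1 - u) * z) / Real.sqrt (1 - F (1 - u) ^ 2))) + z ^ 2 / (4 * D * u)|
        ≤ K / Real.sqrt u := by
  refine ⟨z / Real.sqrt D + 3 + z ^ 2 / 2 * (1 + C / D ^ 2), by positivity,
    min (min δ 1) (min ((D / (2 * C)) ^ 2) (1 / (3 * D))), by positivity, fun u hu hu' => ?_⟩
  simp only [le_min_iff] at hu'
  obtain ⟨⟨huδ, hu1⟩, huC, huD⟩ := hu'
  have hT := hTaylor (1 - u) ⟨by linarith, by linarith⟩
  obtain ⟨v, hv, rfl⟩ : ∃ v : ℝ, 0 < v ∧ u = v ^ 2 :=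
    ⟨Real.sqrt u, Real.sqrt_pos.2 hu, (Real.sq_sqrt hu.le).symm⟩
  rw [Real.sqrt_sq hv.le]
  have hv1 : v ≤ 1 := by nlinarith
  have hpow : (v ^ 2) ^ ((3 : ℝ) / 2) = v ^ 3 := by
    rw [← Real.rpow_natCast, ← Real.rpow_mul hv.le, ← Real.rpow_natCast]
    norm_num
  rw [sub_sub_cancel, hpow] at hT
  have hCv : C * v ≤ D / 2 := by
    have := (sq_le_sq₀ hv.le (by positivity)).1 huC
    rw [le_div_iff₀ (by positivity)] at this
    linarith
  have hDv : 3 * D * v ^ 2 ≤ 1 := by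
    rw [le_div_iff₀ (by positivity)] at huD
    linarith
  generalize F (1 - v ^ 2) = f at hT ⊢
  obtain ⟨hf0, hf1, hq, hq'⟩ := abs_odds_sub_le hD hC hv hCv hDv hT
  have h1f : 0 < 1 - f ^ 2 := by nlinarith
  set x := f * z / Real.sqrt (1 - f ^ 2) with hx
  have hx0 : 0 ≤ x := by positivity
  have hx2 : x ^ 2 = z ^ 2 * (f ^ 2 / (1 - f ^ 2)) := by
    rw [hx, div_pow, Real.sq_sqrt h1f.le]
    ring
  have hxle : x ≤ z / Real.sqrt D / v := by
    refine (sq_le_sq₀ hx0 (by positivity)).1 ?_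
    rw [hx2, div_pow, div_pow, Real.sq_sqrt hD.le]
    calc z ^ 2 * (f ^ 2 / (1 - f ^ 2)) ≤ z ^ 2 * (1 / (D * v ^ 2)) := by gcongr
      _ = z ^ 2 / D / v ^ 2 := by field_simp
  have hP := abs_log_Phi_neg_add_le x hx0
  have hv1' : 1 ≤ 1 / v := by rwa [le_div_iff₀ hv, one_mul]
  have hdiff : |z ^ 2 / (4 * D * v ^ 2) - x ^ 2 / 2| ≤ z ^ 2 / 2 * (1 + C / (D ^ 2 * v)) := by
    have e : z ^ 2 / (4 * D * v ^ 2) - x ^ 2 / 2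
        = -(z ^ 2 / 2 * (f ^ 2 / (1 - f ^ 2) - 1 / (2 * D * v ^ 2))) := by
      rw [hx2]
      field_simp
      ring
    rw [e, abs_neg, abs_mul, abs_of_pos (by positivity : 0 < z ^ 2 / 2)]
    gcongr
  rw [neg_div, ← hx]
  calc |Real.log (Phi (-x)) + z ^ 2 / (4 * D * v ^ 2)|
      = |(Real.log (Phi (-x)) + x ^ 2 / 2) + (z ^ 2 / (4 * D * v ^ 2) - x ^ 2 / 2)| := by ring_nf
    _ ≤ (x + 3) + z ^ 2 / 2 * (1 + C / (D ^ 2 * v)) := (abs_add_le _ _).trans (add_le_add hP hdiff)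
    _ ≤ (z / Real.sqrt D / v + 3 * (1 / v)) + z ^ 2 / 2 * (1 / v + C / (D ^ 2 * v)) := by
        gcongr
        linarith
    _ = (z / Real.sqrt D + 3 + z ^ 2 / 2 * (1 + C / D ^ 2)) / v := by
        field_simp

lemma tendsto_sqrt_div_log_atTop :
    Filter.Tendsto (fun n : ℕ => Real.sqrt (n / Real.log n)) Filter.atTop Filter.atTop := by
  refine Real.tendsto_sqrt_atTop.comp ?_
  have h1 : Filter.Tendsto (fun n : ℕ => Real.sqrt n / 2) Filter.atTop Filter.atTop :=
    (Real.tendsto_sqrt_atTop.comp tendsto_natCast_atTop_atTop).atTop_div_const (by norm_num)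
  refine Filter.tendsto_atTop_mono' _ ?_ h1
  filter_upwards [Filter.eventually_ge_atTop 2] with n hn
  have hn' : (2 : ℝ) ≤ n := by exact_mod_cast hn
  have hL : 0 < Real.log n := Real.log_pos (by linarith)
  have hlog : Real.log n ≤ 2 * Real.sqrt n := by
    have h := Real.log_le_sub_one_of_pos (Real.sqrt_pos.2 (by linarith : (0 : ℝ) < n))
    rw [Real.log_sqrt (by linarith)] at h
    linarith
  rw [div_le_div_iff₀ (by norm_num) hL]
  nlinarith [Real.sq_sqrt (by linarith : (0 : ℝ) ≤ n), Real.sqrt_nonneg (n : ℝ)]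

lemma log_le_four_mul_rpow {x : ℝ} (hx : 0 < x) (hL : 1 ≤ Real.log x) :
    Real.log x ≤ 4 * (x * Real.log x) ^ ((1 : ℝ) / 4) := by
  have h := Real.log_le_rpow_div hx.le (by norm_num : (0 : ℝ) < 1 / 4)
  have h' : x ^ ((1 : ℝ) / 4) ≤ (x * Real.log x) ^ ((1 : ℝ) / 4) :=
    Real.rpow_le_rpow hx.le (by nlinarith) (by norm_num)
  linarith

/-- Asymptotics of the logarithm of the probability
`P_n(a,z) = Φ(-F(1-2h_n/n)z/√(1-F(1-2h_n/n)²))` that a bit string at Hamming distance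
`h_n = ⌊a√(n/ln n)⌋` from a fixed input has a different classification, conditioned on the
output value `√Q z` at the fixed input: `ln P_n(a,z) = -z²√(n ln n)/(8F'(1)a) + O((n ln n)^{1/4})`. -/
theorem log_flip_probability_asymptotics (a z : ℝ) (ha : 0 < a) (hz : 0 < z)
    (F : ℝ → ℝ) (hF1 : F 1 = 1)
    (hFrange : ∀ t ∈ Set.Ico (-1 : ℝ) 1, -1 < F t ∧ F t < 1)
    (D : ℝ) (hD : 0 < D) (C δ : ℝ) (hC : 0 < C) (hδ : 0 < δ)
    (hTaylor : ∀ t ∈ Set.Icc (1 - δ) 1, |F t - 1 + D * (1 - t)| ≤ C * (1 - t) ^ ((3 : ℝ) / 2)) :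
    ∃ K > (0 : ℝ), ∃ n₀ : ℕ, 2 ≤ n₀ ∧ ∀ n : ℕ, n₀ ≤ n →
      |Real.log (Phi (-(F (1 - 2 * (⌊a * Real.sqrt (n / Real.log n)⌋₊ : ℝ) / n) * z) /
            Real.sqrt (1 - (F (1 - 2 * (⌊a * Real.sqrt (n / Real.log n)⌋₊ : ℝ) / n)) ^ 2)))
        + z ^ 2 * Real.sqrt (n * Real.log n) / (8 * D * a)|
        ≤ K * (n * Real.log n) ^ ((1 : ℝ) / 4) := by
  obtain ⟨K, hK, u₀, hu₀, hmain⟩ := exists_abs_log_Phi_add_le z hz F D hD C δ hC hδ hTaylor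
  refine ⟨K / Real.sqrt a + z ^ 2 / (D * a ^ 2), by positivity, ?_⟩
  have hy2 : ∀ᶠ n : ℕ in Filter.atTop, 2 / a ≤ Real.sqrt (n / Real.log n) :=
    tendsto_sqrt_div_log_atTop.eventually_ge_atTop _
  have hlog : ∀ᶠ n : ℕ in Filter.atTop, 1 ≤ Real.log n :=
    (Real.tendsto_log_atTop.comp tendsto_natCast_atTop_atTop).eventually_ge_atTop _
  have hsq : ∀ᶠ n : ℕ in Filter.atTop, 2 * a / u₀ ≤ Real.sqrt n :=
    (Real.tendsto_sqrt_atTop.comp tendsto_natCast_atTop_atTop).eventually_ge_atTop _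
  obtain ⟨n₁, hn₁⟩ := Filter.eventually_atTop.1 (hy2.and (hlog.and hsq))
  refine ⟨max 2 n₁, le_max_left _ _, fun n hn => ?_⟩
  obtain ⟨hy2, hL, hsq⟩ := hn₁ n (le_of_max_le_right hn)
  have hn0 : (0 : ℝ) < n := by
    have : 2 ≤ n := le_of_max_le_left hn
    exact_mod_cast (by omega : 0 < n)
  have hL4 := log_le_four_mul_rpow hn0 hL
  have hL0 : 0 < Real.log n := by linarith
  set L := Real.log n
  set S := Real.sqrt (n * L) with hS
  have hS0 : 0 < S := by positivity
  have hS2 : S ^ 2 = n * L := Real.sq_sqrt (by positivity)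
  have hSroot : Real.sqrt S = (n * L) ^ ((1 : ℝ) / 4) := by
    rw [hS, Real.sqrt_eq_rpow, Real.sqrt_eq_rpow, ← Real.rpow_mul (by positivity)]
    norm_num
  have hnS : Real.sqrt (n / L) = n / S := by
    rw [Real.sqrt_eq_iff_mul_self_eq (by positivity) (by positivity)]
    field_simp
    linarith
  have hsqS : Real.sqrt n ≤ S := Real.sqrt_le_sqrt (by nlinarith)
  rw [← hSroot] at hL4 ⊢
  rw [hnS] at hy2 ⊢
  set y := a * (n / S) with hy
  have hyge : 2 ≤ y := by
    rw [div_le_iff₀ ha] at hy2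
    linarith
  have hfl : (⌊y⌋₊ : ℝ) ≤ y := Nat.floor_le (by linarith)
  have hfl' : y < ⌊y⌋₊ + 1 := Nat.lt_floor_add_one y
  set h : ℝ := (⌊y⌋₊ : ℝ)
  have hh : y / 2 ≤ h := by linarith
  have hh0 : 0 < h := by linarith
  have hu : 2 * h / n ≤ u₀ := by
    rw [div_le_iff₀ hu₀] at hsq
    rw [div_le_iff₀ hn0]
    have : 2 * y ≤ u₀ * n := by
      rw [hy, ← mul_div_assoc, ← mul_div_assoc, div_le_iff₀ hS0]
      have h2a : 2 * a ≤ S * u₀ := hsq.trans (by gcongr)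
      nlinarith [mul_le_mul_of_nonneg_right h2a hn0.le]
    linarith
  have hM := hmain (2 * h / n) (by positivity) hu
  have hny : n / y = S / a := by
    rw [hy]
    field_simp
  have hroot : K / Real.sqrt (2 * h / n) ≤ K / Real.sqrt a * Real.sqrt S := by
    rw [div_mul_eq_mul_div, div_le_div_iff₀ (by positivity) (by positivity), mul_assoc,
      ← Real.sqrt_mul (by positivity)]
    gcongr
    rw [mul_div_assoc', le_div_iff₀ hn0]
    have : a * n = S * y := by
      rw [hy]
      field_simp
    nlinarith
  have hshift : |z ^ 2 * S / (8 * D * a) - z ^ 2 / (4 * D * (2 * h / n))|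
      ≤ z ^ 2 / (D * a ^ 2) * Real.sqrt S := by
    have e : z ^ 2 * S / (8 * D * a) - z ^ 2 / (4 * D * (2 * h / n))
        = -(z ^ 2 / (8 * D) * (n * (y - h) / (h * y))) := by
      rw [show z ^ 2 * S / (8 * D * a) = z ^ 2 / (8 * D) * (S / a) by field_simp, ← hny]
      have : y ≠ 0 := by positivity
      clear_value y h
      field_simp
      ring
    have hyh : 0 ≤ y - h := by linarith
    rw [e, abs_neg, abs_of_nonneg (by positivity)]
    calc z ^ 2 / (8 * D) * (n * (y - h) / (h * y))
        ≤ z ^ 2 / (8 * D) * (n * 1 / (y / 2 * y)) := by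
          gcongr
          linarith
      _ = z ^ 2 / (8 * D) * (2 / n * (n / y) ^ 2) := by
          have : y ≠ 0 := by positivity
          clear_value y
          field_simp
      _ = z ^ 2 / (4 * D * a ^ 2) * L := by
          rw [hny, div_pow, hS2]
          field_simp
          norm_num
      _ ≤ z ^ 2 / (4 * D * a ^ 2) * (4 * Real.sqrt S) := by gcongr
      _ = z ^ 2 / (D * a ^ 2) * Real.sqrt S := by
          field_simp
  rw [add_mul]
  refine le_trans (le_of_eq ?_) ((abs_add_le _ _).trans (add_le_add (hM.trans hroot) hshift))
  ring_nf
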